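/- Let G = W_n^k and C ⊊ V(G). Then γ_gr(G;C) = n − 2k + 1 if and only if there exists i ∈ V\C such that V \ N[i] induces a path and C restricted to this path is a good configuration for it; otherwise γ_gr(G;C) = n − 2k. -/

import Mathlib

/-- The neighborhood `N⟨v⟩`: closed neighborhood if `v ∈ C`, open neighborhood otherwise. -/
def gnbr {V : Type*} (G : SimpleGraph V) (C : Set V) (v : V) : Set V :=
  {u | G.Adj v u ∨ (v ∈ C ∧ u = v)}

/-- A legal sequence of `G;C`: distinct vertices, each element after the first
footprints a vertex not covered by the neighborhoods of its predecessors. -/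
def Legal {V : Type*} (G : SimpleGraph V) (C : Set V) (l : List V) : Prop :=
  l.Nodup ∧ ∀ i (hi : i < l.length), 0 < i →
    ((gnbr G C (l.get ⟨i, hi⟩)) \
      ⋃ j : Fin i, gnbr G C (l.get ⟨j, lt_trans j.2 hi⟩)).Nonempty

/-- A sequence is dominating if the neighborhoods of its vertices cover all of `V`. -/
def Dominating {V : Type*} (G : SimpleGraph V) (C : Set V) (l : List V) : Prop :=
  ∀ u, ∃ v ∈ l, u ∈ gnbr G C v

/-- The general Grundy domination number: maximum length of a legal sequence. -/
noncomputable def grundy {V : Type*} [Fintype V] (G : SimpleGraph V) (C : Set V) : ℕ :=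
  sSup {k | ∃ l : List V, Legal G C l ∧ l.length = k}

/-- Good configuration for the path on vertices `1,…,n` (as a subset of `ℕ`). -/
def gconf : ℕ → Set ℕ → Prop
  | 0, _ => False
  | 1, C => 1 ∈ C
  | 2, C => ¬(1 ∈ C ∧ 2 ∈ C)
  | (n + 3), C =>
      (1 ∉ C ∧ gconf (n + 1) {i | i + 2 ∈ C}) ∨ ((n + 3) ∉ C ∧ gconf (n + 1) C)

/-- The web graph `W_n^k` on vertices `ZMod n`: `i ~ j` iff their circular distance is
between `1` and `k`. -/
def webGraph (n k : ℕ) : SimpleGraph (ZMod n) :=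
  SimpleGraph.fromRel (fun i j => (i - j).val ≤ k)

/-- `S` can be exhausted by neighborhoods each of which meets what is left of `S` in exactly
one vertex. -/
inductive Exhaustible {V : Type*} (N : V → Set V) : Set V → Prop
  | empty : Exhaustible N ∅
  | step {S : Set V} (v x : V) (h : N v ∩ S = {x}) : Exhaustible N (S \ {x}) → Exhaustible N S

/-- Every vertex of the list meets what its predecessors leave uncovered of `S`. -/
def LegalFrom {V : Type*} (N : V → Set V) : Set V → List V → Prop
  | _, [] => True
  | S, v :: l => (N v ∩ S).Nonempty ∧ LegalFrom N (S \ N v) l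

section Exhausting

variable {V : Type*} {N : V → Set V}

theorem Exhaustible.mono {S T : Set V} (hS : Exhaustible N S) (hT : T ⊆ S) : Exhaustible N T := by
  induction hS generalizing T with
  | empty => rw [Set.subset_empty_iff.1 hT]; exact .empty
  | @step S v x h _ ih =>
    have hx : x ∈ N v ∩ S := h ▸ rfl
    by_cases hxT : x ∈ T
    · refine .step v x ?_ (ih (Set.sdiff_subset_sdiff_left hT))
      refine Set.Subset.antisymm ?_ (by rintro _ rfl; exact ⟨hx.1, hxT⟩)
      rw [← h]
      exact Set.inter_subset_inter_right _ hT
    · exact ih fun y hy => ⟨hT hy, fun hyx => hxT (hyx ▸ hy)⟩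

theorem exhaustible_iff_of_inter_eq_singleton {S : Set V} {v x : V} (h : N v ∩ S = {x}) :
    Exhaustible N S ↔ Exhaustible N (S \ {x}) :=
  ⟨fun hS => hS.mono Set.sdiff_subset, .step v x h⟩

theorem Exhaustible.exists_inter_eq_singleton {S : Set V} (h : Exhaustible N S) (hS : S.Nonempty) :
    ∃ v x, N v ∩ S = {x} := by
  cases h with
  | empty => exact absurd hS Set.not_nonempty_empty
  | step v x h _ => exact ⟨v, x, h⟩

theorem Exhaustible.exists_legalFrom [Finite V] {S T : Set V} (hT : Exhaustible N T) (hTS : T ⊆ S) :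
    ∃ l, LegalFrom N S l ∧ l.length = T.ncard := by
  induction hT generalizing S with
  | empty => exact ⟨[], trivial, by simp⟩
  | @step T v x h _ ih =>
    have hx : x ∈ N v ∩ T := h ▸ rfl
    obtain ⟨l, hl, hlen⟩ := ih (S := S \ N v) fun y hy =>
      ⟨hTS hy.1, fun hyv => hy.2 (h ▸ (⟨hyv, hy.1⟩ : y ∈ N v ∩ T))⟩
    refine ⟨v :: l, ⟨⟨x, hx.1, hTS hx.2⟩, hl⟩, ?_⟩
    rw [List.length_cons, hlen, Set.ncard_sdiff_singleton_add_one hx.2]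

theorem LegalFrom.length_le [Finite V] {S : Set V} {l : List V} (hl : LegalFrom N S l) :
    l.length ≤ S.ncard := by
  induction l generalizing S with
  | nil => simp
  | cons v l ih =>
    have h1 := ih hl.2
    have h2 : 0 < (S ∩ N v).ncard := by
      rw [Set.ncard_pos, Set.inter_comm]; exact hl.1
    have h3 := Set.ncard_inter_add_ncard_sdiff_eq_ncard S (N v)
    simp only [List.length_cons]
    omega

theorem LegalFrom.exhaustible [Finite V] {S : Set V} {l : List V} (hl : LegalFrom N S l)
    (hlen : S.ncard ≤ l.length) : Exhaustible N S := by
  induction l generalizing S with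
  | nil =>
    have : S = ∅ := by rw [← Set.ncard_eq_zero]; simpa using hlen
    rw [this]; exact .empty
  | cons v l ih =>
    have h1 := hl.2.length_le
    have h2 : 0 < (S ∩ N v).ncard := by
      rw [Set.ncard_pos, Set.inter_comm]; exact hl.1
    have h3 := Set.ncard_inter_add_ncard_sdiff_eq_ncard S (N v)
    simp only [List.length_cons] at hlen
    obtain ⟨x, hx⟩ := Set.ncard_eq_one.1 (show (S ∩ N v).ncard = 1 by omega)
    refine .step v x (by rw [Set.inter_comm, hx]) ?_
    rw [← hx, Set.sdiff_self_inter]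
    exact ih hl.2 (by omega)

theorem legalFrom_iff {S : Set V} {l : List V} :
    LegalFrom N S l ↔ ∀ (i : ℕ) (hi : i < l.length),
      ∃ w ∈ N l[i], w ∈ S ∧ ∀ (j : ℕ) (hj : j < i), w ∉ N l[j] := by
  induction l generalizing S with
  | nil => simp [LegalFrom]
  | cons v l ih =>
    rw [LegalFrom, ih]
    constructor
    · rintro ⟨⟨w, hw, hwS⟩, h⟩ i hi
      rcases i with _ | i
      · exact ⟨w, hw, hwS, by simp⟩
      · obtain ⟨w, hw, hwS, hwl⟩ := h i (by simpa using hi)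
        refine ⟨w, hw, hwS.1, fun j hj => ?_⟩
        rcases j with _ | j
        · exact hwS.2
        · exact hwl j (by omega)
    · intro h
      refine ⟨?_, fun i hi => ?_⟩
      · obtain ⟨w, hw, hwS, -⟩ := h 0 (by simp)
        exact ⟨w, hw, hwS⟩
      · obtain ⟨w, hw, hwS, hwl⟩ := h (i + 1) (by simpa using hi)
        exact ⟨w, hw, ⟨hwS, hwl 0 (by omega)⟩, fun j hj => hwl (j + 1) (by omega)⟩

theorem LegalFrom.nodup {S : Set V} {l : List V} (hl : LegalFrom N S l) : l.Nodup := by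
  rw [legalFrom_iff] at hl
  rw [List.Nodup, List.pairwise_iff_getElem]
  intro i j hi hj hij h
  obtain ⟨w, hw, -, hwl⟩ := hl j hj
  exact hwl i hij (h ▸ hw)

theorem LegalFrom.notMem {S : Set V} {l : List V} {v : V} (hl : LegalFrom N S l)
    (hv : Disjoint (N v) S) : v ∉ l := by
  rw [legalFrom_iff] at hl
  intro h
  obtain ⟨i, hi, rfl⟩ := List.getElem_of_mem h
  obtain ⟨w, hw, hwS, -⟩ := hl i hi
  exact hv.ne_of_mem hw hwS rfl

theorem legal_cons_iff {G : SimpleGraph V} {C : Set V} {v : V} {l : List V} :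
    Legal G C (v :: l) ↔ LegalFrom (gnbr G C) (gnbr G C v)ᶜ l := by
  constructor
  · rintro ⟨-, h⟩
    rw [legalFrom_iff]
    intro i hi
    obtain ⟨w, hw, hwl⟩ := h (i + 1) (by simpa using hi) (by omega)
    simp only [Set.mem_iUnion, not_exists] at hwl
    exact ⟨w, hw, hwl ⟨0, by omega⟩, fun j hj => hwl ⟨j + 1, by omega⟩⟩
  · intro h
    refine ⟨List.nodup_cons.2 ⟨h.notMem disjoint_compl_right, h.nodup⟩, fun i hi hi0 => ?_⟩
    rw [legalFrom_iff] at h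
    obtain ⟨i, rfl⟩ := Nat.exists_eq_succ_of_ne_zero hi0.ne'
    obtain ⟨w, hw, hwS, hwl⟩ := h i (by simpa using hi)
    refine ⟨w, hw, ?_⟩
    simp only [Set.mem_iUnion, not_exists]
    rintro ⟨_ | j, hj⟩
    · exact hwS
    · exact hwl j (by omega)

end Exhausting

section Coordinates

variable {n k : ℕ} {C : Set (ZMod n)}

/-- The vertices whose position relative to the base point `a` satisfies `P`. -/
def atPos (a : ZMod n) (P : ℕ → Prop) : Set (ZMod n) := {x | P (x - a).val}

theorem add_natCast_mem_atPos {a : ZMod n} {P : ℕ → Prop} {t : ℕ} (ht : t < n) :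
    a + (t : ZMod n) ∈ atPos a P ↔ P t := by
  simp [atPos, ZMod.val_natCast, Nat.mod_eq_of_lt ht]

theorem add_natCast_inj {a : ZMod n} {s t : ℕ} (hs : s < n) (ht : t < n) :
    a + (s : ZMod n) = a + (t : ZMod n) ↔ s = t := by
  rw [add_right_inj, ZMod.natCast_eq_natCast_iff', Nat.mod_eq_of_lt hs, Nat.mod_eq_of_lt ht]

theorem val_natCast_sub_natCast {s t : ℕ} (hs : s < n) (ht : t < n) :
    ((s : ZMod n) - (t : ZMod n)).val = if t ≤ s then s - t else s + n - t := by
  split_ifs with h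
  · rw [← Nat.cast_sub h, ZMod.val_natCast, Nat.mod_eq_of_lt (by omega)]
  · have : ((s : ZMod n) - (t : ZMod n)) = ((s + n - t : ℕ) : ZMod n) := by
      rw [Nat.cast_sub (by omega)]; simp
    rw [this, ZMod.val_natCast, Nat.mod_eq_of_lt (by omega)]

theorem webGraph_adj_iff {a : ZMod n} {s t : ℕ} (hs : s < n) (ht : t < n) :
    (webGraph n k).Adj (a + s) (a + t) ↔
      s ≠ t ∧ (s ≤ t + k ∧ t ≤ s + k ∨ s + n ≤ t + k ∨ t + n ≤ s + k) := by
  rw [webGraph, SimpleGraph.fromRel_adj, Ne, add_natCast_inj hs ht, add_sub_add_left_eq_sub,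
    add_sub_add_left_eq_sub, val_natCast_sub_natCast hs ht, val_natCast_sub_natCast ht hs]
  split_ifs <;> omega

theorem mem_gnbr_iff {a : ZMod n} {s t : ℕ} (hs : s < n) (ht : t < n) :
    a + (t : ZMod n) ∈ gnbr (webGraph n k) C (a + s) ↔
      s ≠ t ∧ (s ≤ t + k ∧ t ≤ s + k ∨ s + n ≤ t + k ∨ t + n ≤ s + k) ∨
        s = t ∧ a + (s : ZMod n) ∈ C := by
  rw [gnbr, Set.mem_ofPred_eq, webGraph_adj_iff hs ht, add_natCast_inj ht hs]
  tauto

theorem pos_of_forall_exists_adj (hC : C ≠ Set.univ)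
    (hiso : ∀ v ∉ C, ∃ u, (webGraph n k).Adj v u) : 0 < k := by
  obtain ⟨v, hv⟩ := (Set.ne_univ_iff_exists_notMem C).1 hC
  obtain ⟨u, huv⟩ := hiso v hv
  rw [webGraph, SimpleGraph.fromRel_adj] at huv
  by_contra hk
  obtain rfl : k = 0 := by omega
  simp only [nonpos_iff_eq_zero, ZMod.val_eq_zero, sub_eq_zero] at huv
  tauto

variable [NeZero n]

theorem exists_eq_add_natCast (a x : ZMod n) : ∃ t < n, x = a + (t : ZMod n) :=
  ⟨(x - a).val, ZMod.val_lt _, by simp⟩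

theorem atPos_mono {a : ZMod n} {P Q : ℕ → Prop} (h : ∀ t < n, P t → Q t) :
    atPos a P ⊆ atPos a Q := fun _ hx => h _ (ZMod.val_lt _) hx

theorem atPos_congr {a : ZMod n} {P Q : ℕ → Prop} (h : ∀ t < n, P t ↔ Q t) :
    atPos a P = atPos a Q :=
  (atPos_mono fun t ht => (h t ht).1).antisymm (atPos_mono fun t ht => (h t ht).2)

theorem atPos_add {a : ZMod n} {P : ℕ → Prop} {c : ℕ} (hc : c < n) :
    atPos (a + (c : ZMod n)) P = atPos a fun t => P (if c ≤ t then t - c else t + n - c) := by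
  ext x
  obtain ⟨t, ht, rfl⟩ := exists_eq_add_natCast a x
  rw [add_natCast_mem_atPos ht, atPos, Set.mem_ofPred_eq, add_sub_add_left_eq_sub,
    val_natCast_sub_natCast ht hc]

theorem ncard_atPos (a : ZMod n) (P : ℕ → Prop) [DecidablePred P] :
    (atPos a P).ncard = ((Finset.range n).filter P).card := by
  rw [← Set.ncard_coe_finset]
  symm
  refine Set.ncard_congr (fun t _ => a + (t : ZMod n)) ?_ ?_ ?_
  · intro t ht
    simp only [Finset.coe_filter, Finset.mem_range, Set.mem_ofPred_eq] at ht
    exact (add_natCast_mem_atPos ht.1).2 ht.2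
  · intro s t hs ht h
    simp only [Finset.coe_filter, Finset.mem_range, Set.mem_ofPred_eq] at hs ht
    exact (add_natCast_inj hs.1 ht.1).1 h
  · intro x hx
    obtain ⟨t, ht, rfl⟩ := exists_eq_add_natCast a x
    rw [add_natCast_mem_atPos ht] at hx
    exact ⟨t, by simp [ht, hx], rfl⟩

theorem gnbr_inter_atPos_eq_singleton {a : ZMod n} {P : ℕ → Prop} {s t : ℕ}
    (ht : t < n) (hP : P t) (hst : a + (t : ZMod n) ∈ gnbr (webGraph n k) C (a + s))
    (h : ∀ r < n, P r → a + (r : ZMod n) ∈ gnbr (webGraph n k) C (a + s) → r = t) :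
    gnbr (webGraph n k) C (a + s) ∩ atPos a P = {a + (t : ZMod n)} := by
  ext x
  obtain ⟨r, hr, rfl⟩ := exists_eq_add_natCast a x
  rw [Set.mem_inter_iff, Set.mem_singleton_iff, add_natCast_inj hr ht, add_natCast_mem_atPos hr]
  exact ⟨fun hx => h r hr hx.2 hx.1, by rintro rfl; exact ⟨hst, hP⟩⟩

/-- Removing the only vertex of `atPos a P` in the neighborhood of `a + s`. -/
theorem exhaustible_atPos_iff {a : ZMod n} {P : ℕ → Prop} (s t : ℕ)
    (ht : t < n) (hP : P t) (hst : a + (t : ZMod n) ∈ gnbr (webGraph n k) C (a + s))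
    (h : ∀ r < n, P r → a + (r : ZMod n) ∈ gnbr (webGraph n k) C (a + s) → r = t) :
    Exhaustible (gnbr (webGraph n k) C) (atPos a P) ↔
      Exhaustible (gnbr (webGraph n k) C) (atPos a fun r => P r ∧ r ≠ t) := by
  rw [exhaustible_iff_of_inter_eq_singleton (gnbr_inter_atPos_eq_singleton ht hP hst h)]
  have : atPos a P \ {a + (t : ZMod n)} = atPos a fun r => P r ∧ r ≠ t := by
    ext x
    obtain ⟨r, hr, rfl⟩ := exists_eq_add_natCast a x
    rw [Set.mem_sdiff, Set.mem_singleton_iff, add_natCast_inj hr ht, add_natCast_mem_atPos hr,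
      add_natCast_mem_atPos hr]
  rw [this]

theorem not_exhaustible_atPos {a : ZMod n} {P : ℕ → Prop} (hP : ∃ t < n, P t)
    (h : ∀ s < n,
      (∃ p < n, ∃ q < n, p ≠ q ∧ P p ∧ P q ∧ a + (p : ZMod n) ∈ gnbr (webGraph n k) C (a + s) ∧
        a + (q : ZMod n) ∈ gnbr (webGraph n k) C (a + s)) ∨
      ∀ p < n, P p → a + (p : ZMod n) ∉ gnbr (webGraph n k) C (a + s)) :
    ¬ Exhaustible (gnbr (webGraph n k) C) (atPos a P) := by
  intro hexh
  obtain ⟨t, ht, hPt⟩ := hP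
  obtain ⟨v, x, hvx⟩ := hexh.exists_inter_eq_singleton ⟨_, (add_natCast_mem_atPos ht).2 hPt⟩
  obtain ⟨s, hs, rfl⟩ := exists_eq_add_natCast a v
  have key : ∀ p < n, P p → a + (p : ZMod n) ∈ gnbr (webGraph n k) C (a + s) →
      a + (p : ZMod n) = x := fun p hp hPp hps =>
    hvx.subset ⟨hps, (add_natCast_mem_atPos hp).2 hPp⟩
  rcases h s hs with ⟨p, hp, q, hq, hpq, hPp, hPq, hps, hqs⟩ | h
  · exact hpq ((add_natCast_inj hp hq).1 ((key p hp hPp hps).trans (key q hq hPq hqs).symm))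
  · have hx : x ∈ gnbr (webGraph n k) C (a + s) ∩ atPos a P := hvx ▸ rfl
    obtain ⟨p, hp, rfl⟩ := exists_eq_add_natCast a x
    exact h p hp ((add_natCast_mem_atPos hp).1 hx.2) hx.1

theorem exhaustible_arc (hk : 0 < k) (a : ZMod n) :
    Exhaustible (gnbr (webGraph n k) C) (atPos a fun t => 2 * k ≤ t) := by
  suffices h : ∀ d c, 2 * k ≤ c → n ≤ c + d →
      Exhaustible (gnbr (webGraph n k) C) (atPos a fun t => c ≤ t) from h n _ le_rfl (by omega)
  intro d
  induction d with
  | zero =>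
    intro c _ hc
    rw [show (atPos a fun t => c ≤ t) = ∅ from
      Set.eq_empty_of_forall_notMem fun x (hx : c ≤ _) => by
        have := ZMod.val_lt (x - a)
        omega]
    exact .empty
  | succ d ih =>
    intro c hc hcd
    by_cases hcn : c < n
    · rw [exhaustible_atPos_iff (c - k) c hcn le_rfl
        (by rw [mem_gnbr_iff (by omega) hcn]; omega)
        (fun r hr hcr h => by rw [mem_gnbr_iff (by omega) hr] at h; omega)]
      exact (ih (c + 1) (by omega) (by omega)).mono (atPos_mono fun t _ ht => by omega)
    · exact ih c hc (by omega)

theorem compl_gnbr (hnk : 2 * (k + 1) ≤ n) (hk : 0 < k) (i : ZMod n) :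
    (gnbr (webGraph n k) C i)ᶜ =
      atPos (i + (k : ZMod n)) fun t => 1 ≤ t ∧ t ≤ n - 2 * k - 1 ∨ t = n - k ∧ i ∉ C := by
  ext x
  obtain ⟨t, ht, rfl⟩ := exists_eq_add_natCast (i + (k : ZMod n)) x
  have hi : i = i + (k : ZMod n) + ((n - k : ℕ) : ZMod n) := by
    rw [Nat.cast_sub (by omega)]; simp
  have key := mem_gnbr_iff (k := k) (C := C) (a := i + (k : ZMod n)) (s := n - k) (by omega) ht
  rw [← hi] at key
  rw [Set.mem_compl_iff, key, add_natCast_mem_atPos ht]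
  by_cases hiC : i ∈ C <;>
    simp only [hiC, not_true, not_false_iff, and_true, and_false, or_false] <;> omega

theorem ncard_compl_gnbr_of_notMem (hnk : 2 * (k + 1) ≤ n) (hk : 0 < k) {i : ZMod n}
    (hi : i ∉ C) : (gnbr (webGraph n k) C i)ᶜ.ncard = n - 2 * k := by
  classical
  rw [compl_gnbr hnk hk, ncard_atPos, show (Finset.range n).filter _ =
    insert (n - k) (Finset.Icc 1 (n - 2 * k - 1)) by ext; simp [hi]; omega,
    Finset.card_insert_of_notMem (by simp; omega), Nat.card_Icc]
  omega

theorem ncard_compl_gnbr_of_mem (hnk : 2 * (k + 1) ≤ n) (hk : 0 < k) {i : ZMod n}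
    (hi : i ∈ C) : (gnbr (webGraph n k) C i)ᶜ.ncard < n - 2 * k := by
  classical
  rw [compl_gnbr hnk hk, ncard_atPos, show (Finset.range n).filter _ =
    Finset.Icc 1 (n - 2 * k - 1) by ext; simp [hi]; omega, Nat.card_Icc]
  omega

theorem not_exhaustible_cycle {m : ℕ} {a : ZMod n} (hm : 1 ≤ m) (hmn : m + 3 ≤ n)
    (hpar : (n - m) % 2 = 1) (hC : ∀ t < n, m + 2 ≤ t → t % 2 = m % 2 → a + (t : ZMod n) ∉ C)
    (h : m = 1 ∧ a + ((1 : ℕ) : ZMod n) ∉ C ∨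
      2 ≤ m ∧ a + ((1 : ℕ) : ZMod n) ∈ C ∧ a + (m : ZMod n) ∈ C) :
    ¬ Exhaustible (gnbr (webGraph n 1) C)
      (atPos a fun t => 1 ≤ t ∧ t ≤ m ∨ m + 2 ≤ t ∧ t % 2 = m % 2) := by
  refine not_exhaustible_atPos ⟨1, by omega, by omega⟩ fun s hs => ?_
  by_cases h0 : s = 0
  · subst h0
    refine .inl ⟨1, by omega, n - 1, by omega, ?_⟩
    rw [mem_gnbr_iff hs (by omega), mem_gnbr_iff hs (by omega)]
    omega
  by_cases hchain : m + 2 ≤ s ∧ s % 2 = m % 2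
  · refine .inr fun p hp hpS => ?_
    rw [mem_gnbr_iff hs hp]
    simp only [hC s hs hchain.1 hchain.2, and_false, or_false]
    omega
  by_cases hsm : m < s
  · refine .inl ⟨s - 1, by omega, s + 1, by omega, ?_⟩
    rw [mem_gnbr_iff hs (by omega), mem_gnbr_iff hs (by omega)]
    omega
  rcases h with ⟨rfl, h1⟩ | ⟨h2, h1, hmC⟩
  · obtain rfl : s = 1 := by omega
    refine .inr fun p hp hpS => ?_
    rw [mem_gnbr_iff hs hp]
    simp only [h1, and_false, or_false]
    omega
  · by_cases hs1 : s = 1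
    · subst hs1
      refine .inl ⟨1, by omega, 2, by omega, ?_⟩
      rw [mem_gnbr_iff hs (by omega), mem_gnbr_iff hs (by omega)]
      simp only [h1, and_true, or_true, true_and]
      omega
    by_cases hsm : s = m
    · subst hsm
      refine .inl ⟨s - 1, by omega, s, by omega, ?_⟩
      rw [mem_gnbr_iff hs (by omega), mem_gnbr_iff hs (by omega)]
      simp only [hmC, and_true, or_true]
      omega
    · refine .inl ⟨s - 1, by omega, s + 1, by omega, ?_⟩
      rw [mem_gnbr_iff hs (by omega), mem_gnbr_iff hs (by omega)]
      omega

theorem exhaustible_cycle_iff {m : ℕ} {a : ZMod n} (hm : 1 ≤ m) (hmn : m + 3 ≤ n)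
    (hpar : (n - m) % 2 = 1) (hC : ∀ t < n, m + 2 ≤ t → t % 2 = m % 2 → a + (t : ZMod n) ∉ C) :
    Exhaustible (gnbr (webGraph n 1) C)
        (atPos a fun t => 1 ≤ t ∧ t ≤ m ∨ m + 2 ≤ t ∧ t % 2 = m % 2) ↔
      gconf m {t : ℕ | a + (t : ZMod n) ∈ C} := by
  induction m using Nat.strong_induction_on generalizing a with
  | _ m ih =>
  match m, hm with
  | 1, _ =>
    simp only [gconf, Set.mem_ofPred_eq]
    refine ⟨fun h => by_contra fun h1 =>
      not_exhaustible_cycle (by omega) hmn hpar hC (.inl ⟨rfl, h1⟩) h, fun h1 => ?_⟩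
    rw [exhaustible_atPos_iff 1 1 (by omega) (by omega)
      (by rw [mem_gnbr_iff (by omega) (by omega)]; exact .inr ⟨rfl, h1⟩)
      (fun r hr hrS h => by
        rw [mem_gnbr_iff (by omega) (by omega)] at h
        omega)]
    exact (exhaustible_arc one_pos a).mono (atPos_mono fun t _ ht => by omega)
  | 2, _ =>
    simp only [gconf, Set.mem_ofPred_eq]
    refine ⟨fun h h12 =>
      not_exhaustible_cycle (by omega) hmn hpar hC (.inr ⟨le_rfl, h12⟩) h, fun h12 => ?_⟩
    by_cases h1 : a + ((1 : ℕ) : ZMod n) ∈ C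
    · have h2 : a + ((2 : ℕ) : ZMod n) ∉ C := fun h2 => h12 ⟨h1, h2⟩
      rw [exhaustible_atPos_iff 2 1 (by omega) (by omega)
        (by rw [mem_gnbr_iff (by omega) (by omega)]; omega)
        (fun r hr hrS h => by
          rw [mem_gnbr_iff (by omega) (by omega)] at h
          simp only [h2, and_false, or_false] at h
          omega)]
      exact (exhaustible_arc one_pos a).mono (atPos_mono fun t _ ht => by omega)
    · rw [exhaustible_atPos_iff 1 2 (by omega) (by omega)
        (by rw [mem_gnbr_iff (by omega) (by omega)]; omega)
        (fun r hr hrS h => by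
          rw [mem_gnbr_iff (by omega) (by omega)] at h
          simp only [h1, and_false, or_false] at h
          omega),
        exhaustible_atPos_iff 2 1 (by omega) (by omega)
        (by rw [mem_gnbr_iff (by omega) (by omega)]; omega)
        (fun r hr hrS h => by
          rw [mem_gnbr_iff (by omega) (by omega)] at h
          omega)]
      exact (exhaustible_arc one_pos a).mono (atPos_mono fun t _ ht => by omega)
  | m + 3, _ =>
    have hleft (h1 : a + ((1 : ℕ) : ZMod n) ∉ C) : Exhaustible (gnbr (webGraph n 1) C)
        (atPos a fun t => 1 ≤ t ∧ t ≤ m + 3 ∨ m + 3 + 2 ≤ t ∧ t % 2 = (m + 3) % 2) ↔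
        gconf (m + 1) {t : ℕ | a + ((t + 2 : ℕ) : ZMod n) ∈ C} := by
      have hadd (t : ℕ) : a + ((t + 2 : ℕ) : ZMod n) = a + ((2 : ℕ) : ZMod n) + t := by
        push_cast; ring
      rw [show {t : ℕ | a + ((t + 2 : ℕ) : ZMod n) ∈ C} =
        {t : ℕ | a + ((2 : ℕ) : ZMod n) + (t : ZMod n) ∈ C} by
          ext t; rw [Set.mem_ofPred_eq, Set.mem_ofPred_eq, hadd]]
      rw [exhaustible_atPos_iff 1 2 (by omega) (by omega)
          (by rw [mem_gnbr_iff (by omega) (by omega)]; omega)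
          (fun r hr hrS h => by
            rw [mem_gnbr_iff (by omega) (by omega)] at h
            simp only [h1, and_false, or_false] at h
            omega),
        ← ih (m + 1) (by omega) (by omega) (by omega) (by omega) ?_, atPos_add (by omega)]
      · refine iff_of_eq (congrArg _ (atPos_congr fun t ht => ?_))
        split_ifs <;> omega
      · intro t ht hmt hpar'
        by_cases htn : t + 2 < n
        · rw [← hadd]
          exact hC (t + 2) htn (by omega) (by omega)
        · obtain rfl : t = n - 1 := by omega
          rw [← hadd, show n - 1 + 2 = n + 1 by omega]
          simpa using h1
    have hright (hm : a + ((m + 3 : ℕ) : ZMod n) ∉ C) : Exhaustible (gnbr (webGraph n 1) C)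
        (atPos a fun t => 1 ≤ t ∧ t ≤ m + 3 ∨ m + 3 + 2 ≤ t ∧ t % 2 = (m + 3) % 2) ↔
        gconf (m + 1) {t : ℕ | a + (t : ZMod n) ∈ C} := by
      rw [exhaustible_atPos_iff (m + 3) (m + 2) (by omega) (by omega)
          (by rw [mem_gnbr_iff (by omega) (by omega)]; omega)
          (fun r hr hrS h => by
            rw [mem_gnbr_iff (by omega) (by omega)] at h
            simp only [hm, and_false, or_false] at h
            omega),
        ← ih (m + 1) (by omega) (by omega) (by omega) (by omega) ?_]
      · refine iff_of_eq (congrArg _ (atPos_congr fun t ht => ?_))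
        omega
      · intro t ht hmt hpar'
        obtain rfl | h : t = m + 3 ∨ m + 3 + 2 ≤ t := by omega
        · exact hm
        · exact hC t ht h (by omega)
    simp only [gconf, Set.mem_ofPred_eq]
    by_cases h1 : a + ((1 : ℕ) : ZMod n) ∈ C <;> by_cases h2 : a + ((m + 3 : ℕ) : ZMod n) ∈ C
    · simp only [h1, h2, not_true, false_and, or_false, iff_false]
      exact not_exhaustible_cycle (by omega) hmn hpar hC
        (.inr ⟨by omega, h1, h2⟩)
    · simp only [h1, h2, not_true, not_false_iff, true_and, false_and, false_or]
      exact hright h2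
    · simp only [h1, h2, not_true, not_false_iff, true_and, false_and, or_false]
      exact hleft h1
    · simp only [h1, h2, not_false_iff, true_and, ← hleft h1, ← hright h2, or_self]

theorem not_exhaustible_web {m : ℕ} {a : ZMod n} (hk : 0 < k) (hm : 1 ≤ m)
    (hmn : n = 2 * k + 1 + m) (hC : a + ((n - k : ℕ) : ZMod n) ∉ C)
    (h : m = 1 ∧ a + ((1 : ℕ) : ZMod n) ∉ C ∨
      m = 2 ∧ a + ((1 : ℕ) : ZMod n) ∈ C ∧ a + ((2 : ℕ) : ZMod n) ∈ C ∨ 3 ≤ m ∧ 2 ≤ k) :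
    ¬ Exhaustible (gnbr (webGraph n k) C) (atPos a fun t => 1 ≤ t ∧ t ≤ m ∨ t = n - k) := by
  refine not_exhaustible_atPos ⟨1, by omega, by omega⟩ fun s hs => ?_
  by_cases h0 : s = n - k
  · subst h0
    refine .inr fun p hp hpS => ?_
    rw [mem_gnbr_iff hs hp]
    simp only [hC, and_false, or_false]
    omega
  by_cases hs1 : s = 0 ∨ n - k < s
  · refine .inl ⟨1, by omega, n - k, by omega, ?_⟩
    rw [mem_gnbr_iff hs (by omega), mem_gnbr_iff hs (by omega)]
    omega
  by_cases hsm : m < s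
  · refine .inl ⟨m, by omega, n - k, by omega, ?_⟩
    rw [mem_gnbr_iff hs (by omega), mem_gnbr_iff hs (by omega)]
    omega
  rcases h with ⟨rfl, h1⟩ | ⟨rfl, h1, h2⟩ | ⟨h3, hk2⟩
  · obtain rfl : s = 1 := by omega
    refine .inr fun p hp hpS => ?_
    rw [mem_gnbr_iff hs hp]
    simp only [h1, and_false, or_false]
    omega
  · refine .inl ⟨1, by omega, 2, by omega, ?_⟩
    rw [mem_gnbr_iff hs (by omega), mem_gnbr_iff hs (by omega)]
    obtain rfl | rfl : s = 1 ∨ s = 2 := by omega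
    · simp only [h1, and_true, or_true, true_and]
      omega
    · simp only [h2, and_true, or_true]
      omega
  · by_cases h1 : s = 1
    · refine .inl ⟨2, by omega, 3, by omega, ?_⟩
      rw [mem_gnbr_iff hs (by omega), mem_gnbr_iff hs (by omega)]
      omega
    by_cases h2 : s = m
    · refine .inl ⟨s - 1, by omega, s - 2, by omega, ?_⟩
      rw [mem_gnbr_iff hs (by omega), mem_gnbr_iff hs (by omega)]
      omega
    · refine .inl ⟨s - 1, by omega, s + 1, by omega, ?_⟩
      rw [mem_gnbr_iff hs (by omega), mem_gnbr_iff hs (by omega)]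
      omega

theorem exhaustible_atPos_of_forall_eq {a : ZMod n} {P : ℕ → Prop} (hk : 0 < k) {t : ℕ}
    (ht0 : 1 ≤ t) (ht : t < n) (hP : ∀ r < n, P r → r = t) :
    Exhaustible (gnbr (webGraph n k) C) (atPos a P) := by
  refine Exhaustible.mono ?_ (atPos_mono (Q := fun r => r = t) hP)
  refine (exhaustible_atPos_iff (P := fun r => r = t) (t - 1) t ht rfl
    (by rw [mem_gnbr_iff (by omega) (by omega)]; omega) fun r _ hrt _ => hrt).2 ?_
  exact Exhaustible.empty.mono fun x hx => hx.2 hx.1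

theorem exhaustible_web_iff {m : ℕ} {a : ZMod n} (hk : 0 < k) (hm : 1 ≤ m) (hm2 : m ≤ 2)
    (hmn : n = 2 * k + 1 + m) (hC : a + ((n - k : ℕ) : ZMod n) ∉ C) :
    Exhaustible (gnbr (webGraph n k) C) (atPos a fun t => 1 ≤ t ∧ t ≤ m ∨ t = n - k) ↔
      gconf m {t : ℕ | a + (t : ZMod n) ∈ C} := by
  obtain rfl | rfl : m = 1 ∨ m = 2 := by omega
  · simp only [gconf, Set.mem_ofPred_eq]
    refine ⟨fun h => by_contra fun h1 =>
      not_exhaustible_web hk hm hmn hC (.inl ⟨rfl, h1⟩) h, fun h1 => ?_⟩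
    rw [exhaustible_atPos_iff 1 1 (by omega) (by omega)
      (by rw [mem_gnbr_iff (by omega) (by omega)]; exact .inr ⟨rfl, h1⟩)
      (fun r hr hrS h => by
        rw [mem_gnbr_iff (by omega) (by omega)] at h
        omega)]
    exact exhaustible_atPos_of_forall_eq hk (t := n - k) (by omega) (by omega)
        fun r _ h => by omega
  · simp only [gconf, Set.mem_ofPred_eq]
    refine ⟨fun h h12 =>
      not_exhaustible_web hk hm hmn hC (.inr (.inl ⟨rfl, h12⟩)) h, fun h12 => ?_⟩
    by_cases h1 : a + ((1 : ℕ) : ZMod n) ∈ C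
    · have h2 : a + ((2 : ℕ) : ZMod n) ∉ C := fun h2 => h12 ⟨h1, h2⟩
      rw [exhaustible_atPos_iff 2 1 (by omega) (by omega)
        (by rw [mem_gnbr_iff (by omega) (by omega)]; omega)
        (fun r hr hrS h => by
          rw [mem_gnbr_iff (by omega) (by omega)] at h
          simp only [h2, and_false, or_false] at h
          omega),
        exhaustible_atPos_iff 1 2 (by omega) (by omega)
        (by rw [mem_gnbr_iff (by omega) (by omega)]; omega)
        (fun r hr hrS h => by
          rw [mem_gnbr_iff (by omega) (by omega)] at h
          omega)]
      exact exhaustible_atPos_of_forall_eq hk (t := n - k) (by omega) (by omega)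
        fun r _ h => by omega
    · rw [exhaustible_atPos_iff 1 2 (by omega) (by omega)
        (by rw [mem_gnbr_iff (by omega) (by omega)]; omega)
        (fun r hr hrS h => by
          rw [mem_gnbr_iff (by omega) (by omega)] at h
          simp only [h1, and_false, or_false] at h
          omega),
        exhaustible_atPos_iff 2 1 (by omega) (by omega)
        (by rw [mem_gnbr_iff (by omega) (by omega)]; omega)
        (fun r hr hrS h => by
          rw [mem_gnbr_iff (by omega) (by omega)] at h
          omega)]
      exact exhaustible_atPos_of_forall_eq hk (t := n - k) (by omega) (by omega)
        fun r _ h => by omega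

theorem exhaustible_compl_gnbr_iff (hnk : 2 * (k + 1) ≤ n) (hk : 0 < k) {i : ZMod n} (hi : i ∉ C) :
    Exhaustible (gnbr (webGraph n k) C) (gnbr (webGraph n k) C i)ᶜ ↔
      (k = 1 ∨ n - 2 * k - 1 ≤ 2) ∧
        gconf (n - 2 * k - 1) {t : ℕ | i + ((k : ZMod n) + (t : ZMod n)) ∈ C} := by
  have hi' : i + (k : ZMod n) + ((n - k : ℕ) : ZMod n) ∉ C := by
    rw [Nat.cast_sub (by omega)]; simpa using hi
  simp only [compl_gnbr hnk hk, hi, not_false_iff, and_true, ← add_assoc]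
  by_cases h2 : n - 2 * k - 1 ≤ 2
  · simp only [h2, or_true, true_and]
    exact exhaustible_web_iff hk (by omega) h2 (by omega) hi'
  by_cases h1 : k = 1
  · subst h1
    simp only [true_or, true_and]
    rw [← exhaustible_cycle_iff (by omega) (by omega) (by omega) fun t ht hmt hpar => by
      obtain rfl : t = n - 1 := by omega
      exact hi']
    refine iff_of_eq (congrArg _ (atPos_congr fun t ht => ?_))
    omega
  · simp only [h1, h2, or_self, false_and, iff_false]
    exact not_exhaustible_web hk (by omega) (by omega) hi' (.inr (.inr (by omega)))

theorem compl_insert_neighborSet (hnk : 2 * (k + 1) ≤ n) (hk : 0 < k) (i : ZMod n) :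
    (insert i ((webGraph n k).neighborSet i))ᶜ =
      atPos (i + (k : ZMod n)) fun t => 1 ≤ t ∧ t ≤ n - 2 * k - 1 := by
  have h := compl_gnbr (C := Set.univ) hnk hk i
  simp only [Set.mem_univ, not_true, and_false, or_false] at h
  rw [← h]
  congr 1
  ext x
  simp [gnbr, or_comm]

theorem nonempty_iso_pathGraph_iff (hnk : 2 * (k + 1) ≤ n) (hk : 0 < k) (i : ZMod n) :
    Nonempty ((SimpleGraph.induce (insert i ((webGraph n k).neighborSet i))ᶜ
        (webGraph n k)) ≃g SimpleGraph.pathGraph (n - 2 * k - 1)) ↔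
      k = 1 ∨ n - 2 * k - 1 ≤ 2 := by
  rw [compl_insert_neighborSet hnk hk]
  set a := i + (k : ZMod n)
  constructor
  · rintro ⟨e⟩
    by_contra! h
    have hmem (t : ℕ) (h1 : 1 ≤ t) (h3 : t ≤ 3) :
        a + (t : ZMod n) ∈ atPos a fun t => 1 ≤ t ∧ t ≤ n - 2 * k - 1 :=
      (add_natCast_mem_atPos (by omega)).2 (by omega)
    have hadj (s t : ℕ) (hs1 : 1 ≤ s) (hs3 : s ≤ 3) (ht1 : 1 ≤ t) (ht3 : t ≤ 3) (hst : s ≠ t) :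
        (SimpleGraph.pathGraph (n - 2 * k - 1)).Adj (e ⟨_, hmem s hs1 hs3⟩)
          (e ⟨_, hmem t ht1 ht3⟩) := by
      rw [e.map_adj_iff, SimpleGraph.comap_adj]
      exact (webGraph_adj_iff (by omega) (by omega)).2 (by omega)
    have h12 := hadj 1 2 (by omega) (by omega) (by omega) (by omega) (by omega)
    have h13 := hadj 1 3 (by omega) (by omega) (by omega) (by omega) (by omega)
    have h23 := hadj 2 3 (by omega) (by omega) (by omega) (by omega) (by omega)
    rw [SimpleGraph.pathGraph_adj] at h12 h13 h23
    omega
  · intro h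
    let f (t : Fin (n - 2 * k - 1)) : atPos a fun t => 1 ≤ t ∧ t ≤ n - 2 * k - 1 :=
      ⟨a + ((t + 1 : ℕ) : ZMod n), (add_natCast_mem_atPos (by omega)).2 (by omega)⟩
    have hf : Function.Bijective f := by
      constructor
      · intro s t hst
        have := (add_natCast_inj (by omega) (by omega)).1 (congrArg Subtype.val hst)
        omega
      · rintro ⟨x, hx⟩
        obtain ⟨t, ht, rfl⟩ := exists_eq_add_natCast a x
        have ht' := (add_natCast_mem_atPos ht).1 hx
        refine ⟨⟨t - 1, by omega⟩, Subtype.ext ?_⟩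
        simp only [f, Nat.sub_add_cancel ht'.1]
    refine ⟨RelIso.symm ⟨Equiv.ofBijective f hf, fun {s t} => ?_⟩⟩
    rw [SimpleGraph.pathGraph_adj, SimpleGraph.comap_adj]
    refine (webGraph_adj_iff (by omega) (by omega)).trans ?_
    omega

theorem exists_legal_length_eq (hnk : 2 * (k + 1) ≤ n) (hk : 0 < k) :
    ∃ l, Legal (webGraph n k) C l ∧ l.length = n - 2 * k := by
  classical
  have hT : Exhaustible (gnbr (webGraph n k) C) (atPos 0 fun t => 2 * k ≤ t ∧ t ≤ n - 2) :=
    (exhaustible_arc hk 0).mono (atPos_mono fun t _ ht => ht.1)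
  have hsub : atPos 0 (fun t => 2 * k ≤ t ∧ t ≤ n - 2) ⊆
      (gnbr (webGraph n k) C (0 + ((k - 1 : ℕ) : ZMod n)))ᶜ := by
    intro x hx
    obtain ⟨t, ht, rfl⟩ := exists_eq_add_natCast 0 x
    rw [add_natCast_mem_atPos ht] at hx
    rw [Set.mem_compl_iff, mem_gnbr_iff (by omega) ht]
    omega
  obtain ⟨l, hl, hlen⟩ := hT.exists_legalFrom hsub
  refine ⟨_ :: l, legal_cons_iff.2 hl, ?_⟩
  rw [List.length_cons, hlen, ncard_atPos, show (Finset.range n).filter _ =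
    Finset.Icc (2 * k) (n - 2) by ext; simp; omega, Nat.card_Icc]
  omega

theorem Legal.length_le (hnk : 2 * (k + 1) ≤ n) (hk : 0 < k) {l : List (ZMod n)}
    (hl : Legal (webGraph n k) C l) : l.length ≤ n - 2 * k + 1 := by
  match l, hl with
  | [], _ => simp
  | i :: l, hl =>
    have h := (legal_cons_iff.1 hl).length_le
    rw [List.length_cons]
    by_cases hi : i ∈ C
    · have := ncard_compl_gnbr_of_mem hnk hk hi
      omega
    · rw [ncard_compl_gnbr_of_notMem hnk hk hi] at h
      omega

theorem exists_legal_length_eq_add_one_iff (hnk : 2 * (k + 1) ≤ n) (hk : 0 < k) :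
    (∃ l, Legal (webGraph n k) C l ∧ l.length = n - 2 * k + 1) ↔
      ∃ i ∉ C, Exhaustible (gnbr (webGraph n k) C) (gnbr (webGraph n k) C i)ᶜ := by
  constructor
  · rintro ⟨l, hl, hlen⟩
    match l, hl, hlen with
    | i :: l, hl, hlen =>
      rw [List.length_cons] at hlen
      rw [legal_cons_iff] at hl
      have h := hl.length_le
      have hi : i ∉ C := fun hi => by
        have := ncard_compl_gnbr_of_mem hnk hk hi
        omega
      refine ⟨i, hi, hl.exhaustible ?_⟩
      rw [ncard_compl_gnbr_of_notMem hnk hk hi]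
      omega
  · rintro ⟨i, hi, h⟩
    obtain ⟨l, hl, hlen⟩ := h.exists_legalFrom subset_rfl
    refine ⟨i :: l, legal_cons_iff.2 hl, ?_⟩
    rw [List.length_cons, hlen, ncard_compl_gnbr_of_notMem hnk hk hi]

end Coordinates

theorem grundy_eq_of_isGreatest {V : Type*} [Fintype V] {G : SimpleGraph V} {C : Set V} {d : ℕ}
    (h : ∃ l, Legal G C l ∧ l.length = d) (hle : ∀ l, Legal G C l → l.length ≤ d) :
    grundy G C = d :=
  IsGreatest.csSup_eq ⟨h, by rintro _ ⟨l, hl, rfl⟩; exact hle l hl⟩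

theorem stmt11 (n k : ℕ) [NeZero n] (hnk : 2 * (k + 1) ≤ n) (C : Set (ZMod n))
    (hC : C ≠ Set.univ) (hiso : ∀ v ∉ C, ∃ u, (webGraph n k).Adj v u) :
    (grundy (webGraph n k) C = n - 2 * k + 1 ↔
      ∃ i ∉ C,
        Nonempty ((SimpleGraph.induce (insert i ((webGraph n k).neighborSet i))ᶜ
            (webGraph n k)) ≃g SimpleGraph.pathGraph (n - 2 * k - 1)) ∧
        gconf (n - 2 * k - 1) {t : ℕ | i + ((k : ZMod n) + (t : ZMod n)) ∈ C}) ∧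
    (¬ (∃ i ∉ C,
        Nonempty ((SimpleGraph.induce (insert i ((webGraph n k).neighborSet i))ᶜ
            (webGraph n k)) ≃g SimpleGraph.pathGraph (n - 2 * k - 1)) ∧
        gconf (n - 2 * k - 1) {t : ℕ | i + ((k : ZMod n) + (t : ZMod n)) ∈ C}) →
      grundy (webGraph n k) C = n - 2 * k) := by
  have hk := pos_of_forall_exists_adj hC hiso
  have hiff : (∃ l, Legal (webGraph n k) C l ∧ l.length = n - 2 * k + 1) ↔ _ :=
    (exists_legal_length_eq_add_one_iff hnk hk).trans <| exists_congr fun i =>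
      and_congr_right fun hi => (exhaustible_compl_gnbr_iff hnk hk hi).trans <|
        and_congr_left' (nonempty_iso_pathGraph_iff hnk hk i).symm
  rw [← hiff]
  have hlow (h : ¬ ∃ l, Legal (webGraph n k) C l ∧ l.length = n - 2 * k + 1) :
      grundy (webGraph n k) C = n - 2 * k := by
    refine grundy_eq_of_isGreatest (exists_legal_length_eq hnk hk) fun l hl => ?_
    have h1 := hl.length_le hnk hk
    have h2 : l.length ≠ n - 2 * k + 1 := fun h2 => h ⟨l, hl, h2⟩
    omega
  refine ⟨⟨fun h => by_contra fun h' => ?_, fun h => ?_⟩, hlow⟩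
  · have := hlow h'
    omega
  · exact grundy_eq_of_isGreatest h fun l hl => hl.length_le hnk hk
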